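/- Downward behaviour from downward-repulsive states: suppose x0 ∈ ℝ^n is in the downward-repulsive class, i.e., there exists a maximal cohesive set M such that, letting Θ = argmax_{i∈M} x0_i, no cohesive set contained in Θ ∪ (V\M) contains any element of Θ. Then there exist ε > 0 and a time τ ≥ 0 such that φ(τ,x0) ∈ X^b := {x ∈ ℝ^n : x_j ≤ max_{i∈M} x0_i − ε for all j ∈ M}, where X^b is positively invariant for the CTWM dynamics and is at positive distance from x0. -/

import Mathlib

open Finset Filter Topology

/-- `m` is a weighted median of the values `x` with respect to weights `w`. -/
def IsWeightedMedian {n : ℕ} (x w : Fin n → ℝ) (m : ℝ) : Prop :=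
  (∃ i, x i = m) ∧
  ∑ i ∈ univ.filter (fun i => x i < m), w i ≤ 1 / 2 ∧
  ∑ i ∈ univ.filter (fun i => m < x i), w i ≤ 1 / 2

/-- `W` is a row-stochastic matrix. -/
def RowStochastic {n : ℕ} (W : Matrix (Fin n) (Fin n) ℝ) : Prop :=
  (∀ i j, 0 ≤ W i j) ∧ ∀ i, ∑ j, W i j = 1

/-- `M` is a cohesive set of the influence network `G(W)`. -/
def Cohesive {n : ℕ} (W : Matrix (Fin n) (Fin n) ℝ) (M : Finset (Fin n)) : Prop :=
  ∀ i ∈ M, (1 : ℝ) / 2 ≤ ∑ j ∈ M, W i j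

/-- `M` is a maximal cohesive set of the influence network `G(W)`. -/
def MaxCohesive {n : ℕ} (W : Matrix (Fin n) (Fin n) ℝ) (M : Finset (Fin n)) : Prop :=
  Cohesive W M ∧ ∀ i ∉ M, ¬ ((1 : ℝ) / 2 < ∑ j ∈ M, W i j)

/-- `Med` is the weighted-median operator: `Med x i` is the weighted median of `x`
with respect to the `i`-th row of `W` that is closest to `x i`. -/
def IsMedSelection {n : ℕ} (W : Matrix (Fin n) (Fin n) ℝ)
    (Med : (Fin n → ℝ) → Fin n → ℝ) : Prop :=
  ∀ x i, IsWeightedMedian x (W i) (Med x i) ∧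
    ∀ m, IsWeightedMedian x (W i) m → |Med x i - x i| ≤ |m - x i|

/-- `φ` is the solution map of the ODE `ẋ = g(x)`: `φ x0` is the solution starting at `x0`. -/
def IsFlow {n : ℕ} (g : (Fin n → ℝ) → (Fin n → ℝ))
    (φ : (Fin n → ℝ) → ℝ → (Fin n → ℝ)) : Prop :=
  ∀ x, φ x 0 = x ∧ ∀ t : ℝ, HasDerivAt (φ x) (g (φ x t)) t

/-- `order^{≤ r}(x)`: indices whose value is among the `r` largest distinct values of `x`. -/
noncomputable def orderLe {n : ℕ} (x : Fin n → ℝ) (r : ℕ) : Finset (Fin n) :=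
  univ.filter (fun i => ((univ.image x).filter (fun v => x i < v)).card < r)

/-- The set of equilibria of the CTWM dynamics. -/
def Xeq {n : ℕ} (W : Matrix (Fin n) (Fin n) ℝ) : Set (Fin n → ℝ) :=
  {x | ∀ r : ℕ, 1 ≤ r → r ≤ (univ.image x).card → MaxCohesive W (orderLe x r)}

/-- The ω-limit set of a trajectory `φ`. -/
def omegaLimitSet {n : ℕ} (φ : ℝ → (Fin n → ℝ)) : Set (Fin n → ℝ) :=
  {z | ∃ u : ℕ → ℝ, Tendsto u atTop atTop ∧ Tendsto (fun k => φ (u k)) atTop (𝓝 z)}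

/-- The set `{x : xⱼ ≤ c - ε for all j ∈ M}`. -/
def lowerInvSet {n : ℕ} (M : Finset (Fin n)) (c ε : ℝ) : Set (Fin n → ℝ) :=
  {x | ∀ j ∈ M, x j ≤ c - ε}

/-- If the weighted median moves node `i` upwards, then strictly less than half of its weight lies
strictly below that median. -/
lemma IsMedSelection.sum_lt_half {n : ℕ} {W : Matrix (Fin n) (Fin n) ℝ} (hW : RowStochastic W)
    {Med : (Fin n → ℝ) → Fin n → ℝ} (hMed : IsMedSelection W Med) {x : Fin n → ℝ} {i : Fin n}
    (hi : x i < Med x i) :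
    ∑ j ∈ univ.filter (fun j => x j < Med x i), W i j < 1 / 2 := by
  obtain ⟨⟨-, hlow, -⟩, hclosest⟩ := hMed x i
  by_contra! hhalf
  have hmem : i ∈ univ.filter (fun j => x j < Med x i) := by simpa using hi
  obtain ⟨k, hk, hmax⟩ := exists_max_image (univ.filter (fun j => x j < Med x i)) x ⟨i, hmem⟩
  have hk' : x k < Med x i := by simpa using hk
  have hik : x i ≤ x k := hmax i hmem
  have hmedian : IsWeightedMedian x (W i) (x k) := by
    refine ⟨⟨k, rfl⟩, le_trans (sum_le_sum_of_subset_of_nonneg ?_ fun j _ _ => hW.1 i j) hlow, ?_⟩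
    · intro j hj
      simp only [mem_filter, mem_univ, true_and] at hj ⊢
      exact hj.trans hk'
    · have hsplit := sum_filter_add_sum_filter_not univ (fun j => x j < Med x i) (W i)
      rw [hW.2 i] at hsplit
      have hsub : ∑ j ∈ univ.filter (fun j => x k < x j), W i j ≤
          ∑ j ∈ univ.filter (fun j => ¬ x j < Med x i), W i j := by
        refine sum_le_sum_of_subset_of_nonneg ?_ fun j _ _ => hW.1 i j
        intro j hj
        simp only [mem_filter, mem_univ, true_and] at hj ⊢
        exact fun hlt => absurd (hmax j (by simpa using hlt)) (not_le.2 hj)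
      linarith
  have hdist := hclosest _ hmedian
  rw [abs_of_pos (by linarith), abs_of_nonneg (by linarith)] at hdist
  linarith

/-- On a cohesive set, an upper bound for the opinions is an upper bound for the medians. -/
lemma Cohesive.med_le {n : ℕ} {W : Matrix (Fin n) (Fin n) ℝ} (hW : RowStochastic W)
    {Med : (Fin n → ℝ) → Fin n → ℝ} (hMed : IsMedSelection W Med) {M : Finset (Fin n)}
    (hM : Cohesive W M) {x : Fin n → ℝ} {a : ℝ} (hx : ∀ j ∈ M, x j ≤ a) {i : Fin n} (hi : i ∈ M) :
    Med x i ≤ a := by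
  by_contra! hlt
  have hsum := hMed.sum_lt_half hW ((hx i hi).trans_lt hlt)
  have hsub : ∑ j ∈ M, W i j ≤ ∑ j ∈ univ.filter (fun j => x j < Med x i), W i j := by
    refine sum_le_sum_of_subset_of_nonneg ?_ fun j _ _ => hW.1 i j
    intro j hj
    simpa using (hx j hj).trans_lt hlt
  linarith [hM i hi]

/-- A finite family of functions that is initially negative, and whose members have negative
derivative whenever they reach zero while all the others are nonpositive, stays negative. -/
lemma forall_neg_of_deriv_neg_at_zero {ι : Type*} {s : Finset ι} {f f' : ι → ℝ → ℝ}
    (hf : ∀ i ∈ s, ∀ t, HasDerivAt (f i) (f' i t) t) (h0 : ∀ i ∈ s, f i 0 < 0)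
    (hneg : ∀ t, 0 ≤ t → (∀ i ∈ s, f i t ≤ 0) → ∀ i ∈ s, f i t = 0 → f' i t < 0)
    {t : ℝ} (ht : 0 ≤ t) {i : ι} (hi : i ∈ s) : f i t < 0 := by
  by_contra! hit
  set T : Set ℝ := ⋃ i ∈ s, {t | 0 ≤ t ∧ 0 ≤ f i t} with hT
  have hclosed : IsClosed T := by
    refine s.finite_toSet.isClosed_biUnion fun j hj => ?_
    have hcont : Continuous (f j) := continuous_iff_continuousAt.2 fun t => (hf j hj t).continuousAt
    exact (isClosed_le continuous_const continuous_id).inter (isClosed_le continuous_const hcont)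
  have hbdd : BddBelow T := by
    refine ⟨0, fun r hr => ?_⟩
    simp only [hT, Set.mem_iUnion] at hr
    obtain ⟨_, _, hr, _⟩ := hr
    exact hr
  have hne : T.Nonempty := ⟨t, by simp only [hT, Set.mem_iUnion]; exact ⟨i, hi, ht, hit⟩⟩
  have hmem := hclosed.csInf_mem hne hbdd
  set r := sInf T
  simp only [hT, Set.mem_iUnion] at hmem
  obtain ⟨j, hj, hr0, hjr⟩ := hmem
  have hrpos : 0 < r := by
    rcases hr0.eq_or_lt with h | h
    · rw [← h] at hjr
      linarith [h0 j hj]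
    · exact h
  have hbefore : ∀ᶠ u in 𝓝[<] r, ∀ k ∈ s, f k u < 0 := by
    filter_upwards [Ioo_mem_nhdsLT hrpos] with u hu k hk
    by_contra! hku
    refine absurd (csInf_le hbdd (?_ : u ∈ T)) (not_le.2 hu.2)
    simp only [hT, Set.mem_iUnion]
    exact ⟨k, hk, hu.1.le, hku⟩
  have hle : ∀ k ∈ s, f k r ≤ 0 := fun k hk =>
    le_of_tendsto ((hf k hk r).continuousAt.tendsto.mono_left nhdsWithin_le_nhds)
      (hbefore.mono fun u hu => (hu k hk).le)
  have hjr0 : f j r = 0 := le_antisymm (hle j hj) hjr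
  have hslope : Tendsto (slope (f j) r) (𝓝[<] r) (𝓝 (f' j r)) :=
    (hasDerivAt_iff_tendsto_slope.1 (hf j hj r)).mono_left
      (nhdsWithin_mono _ fun u hu => ne_of_lt hu)
  have hnonneg : 0 ≤ f' j r := by
    refine ge_of_tendsto hslope ?_
    filter_upwards [hbefore, self_mem_nhdsWithin] with u hu hur
    rw [slope_def_field, hjr0, sub_zero]
    exact div_nonneg_of_nonpos (hu j hj).le (sub_nonpos.2 (le_of_lt hur))
  exact absurd (hneg r hr0 hle j hj hjr0) (not_lt.2 hnonneg)

/-- An upper bound for the opinions of a cohesive set is preserved by the dynamics. -/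
lemma Cohesive.flow_le {n : ℕ} {W : Matrix (Fin n) (Fin n) ℝ} (hW : RowStochastic W)
    {Med : (Fin n → ℝ) → Fin n → ℝ} (hMed : IsMedSelection W Med)
    {φ : (Fin n → ℝ) → ℝ → (Fin n → ℝ)} (hφ : IsFlow (fun x => Med x - x) φ)
    {M : Finset (Fin n)} (hM : Cohesive W M) {y : Fin n → ℝ} {a : ℝ} (hy : ∀ j ∈ M, y j ≤ a)
    {t : ℝ} (ht : 0 ≤ t) {j : Fin n} (hj : j ∈ M) : φ y t j ≤ a := by
  have hlt : ∀ δ > 0, φ y t j < a + δ * (1 + t) := by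
    intro δ hδ
    have h := forall_neg_of_deriv_neg_at_zero (s := M)
      (f := fun k u => φ y u k - (a + δ * (1 + u)))
      (f' := fun k u => (Med (φ y u) k - φ y u k) - δ) ?_ ?_ ?_ ht hj
    · simpa using h
    · intro k _ u
      have hlin : HasDerivAt (fun u : ℝ => a + δ * (1 + u)) δ u := by
        simpa using (((hasDerivAt_id u).const_add 1).const_mul δ).const_add a
      exact (hasDerivAt_pi.1 ((hφ y).2 u) k).sub hlin
    · intro k hk
      simp only [(hφ y).1]
      linarith [hy k hk]
    · intro u _ hall k hk hzero
      have hmed := hM.med_le hW hMed (fun l hl => sub_nonpos.1 (hall l hl)) hk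
      linarith
  refine le_of_forall_pos_lt_add fun η hη => ?_
  have hpos : 0 < 1 + t := by linarith
  simpa [div_mul_cancel₀ η hpos.ne'] using hlt (η / (1 + t)) (div_pos hη hpos)

/-- A node of a cohesive set that starts strictly below an upper bound of the opinions of that set
stays strictly below it. -/
lemma Cohesive.flow_lt {n : ℕ} {W : Matrix (Fin n) (Fin n) ℝ} (hW : RowStochastic W)
    {Med : (Fin n → ℝ) → Fin n → ℝ} (hMed : IsMedSelection W Med)
    {φ : (Fin n → ℝ) → ℝ → (Fin n → ℝ)} (hφ : IsFlow (fun x => Med x - x) φ)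
    {M : Finset (Fin n)} (hM : Cohesive W M) {y : Fin n → ℝ} {a : ℝ} (hy : ∀ j ∈ M, y j ≤ a)
    {t : ℝ} (ht : 0 ≤ t) {j : Fin n} (hj : j ∈ M) (hlt : y j < a) : φ y t j < a := by
  have hderiv : ∀ u, HasDerivAt (fun u => Real.exp u * (a - φ y u j))
      (Real.exp u * (a - Med (φ y u) j)) u := by
    intro u
    have h := (Real.hasDerivAt_exp u).mul ((hasDerivAt_pi.1 ((hφ y).2 u) j).const_sub a)
    refine h.congr_deriv ?_
    simp only [Pi.sub_apply]
    ring
  have hmono : MonotoneOn (fun u => Real.exp u * (a - φ y u j)) (Set.Ici 0) := by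
    refine monotoneOn_of_hasDerivWithinAt_nonneg (convex_Ici 0)
      (fun u _ => (hderiv u).continuousAt.continuousWithinAt)
      (fun u _ => (hderiv u).hasDerivWithinAt) fun u hu => ?_
    rw [interior_Ici] at hu
    have hmed := hM.med_le hW hMed (fun l hl => hM.flow_le hW hMed hφ hy (le_of_lt hu) hl) hj
    exact mul_nonneg (Real.exp_pos u).le (sub_nonneg.2 hmed)
  have hle := hmono Set.self_mem_Ici (Set.mem_Ici.2 ht) ht
  simp only [(hφ y).1, Real.exp_zero, one_mul] at hle
  exact sub_pos.1 (pos_of_mul_pos_right ((sub_pos.2 hlt).trans_le hle) (Real.exp_pos t).le)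

/-- If the opinions of a cohesive set are bounded above by `a`, then a node of that set whose
opinion equals `a` at a positive time has weighted median `a` at that time. -/
lemma Cohesive.med_eq_of_flow_eq {n : ℕ} {W : Matrix (Fin n) (Fin n) ℝ} (hW : RowStochastic W)
    {Med : (Fin n → ℝ) → Fin n → ℝ} (hMed : IsMedSelection W Med)
    {φ : (Fin n → ℝ) → ℝ → (Fin n → ℝ)} (hφ : IsFlow (fun x => Med x - x) φ)
    {M : Finset (Fin n)} (hM : Cohesive W M) {y : Fin n → ℝ} {a : ℝ} (hy : ∀ j ∈ M, y j ≤ a)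
    {t : ℝ} (ht : 0 < t) {j : Fin n} (hj : j ∈ M) (heq : φ y t j = a) : Med (φ y t) j = a := by
  have hmax : IsLocalMax (fun u => φ y u j) t := by
    filter_upwards [lt_mem_nhds ht] with u hu
    rw [heq]
    exact hM.flow_le hW hMed hφ hy hu.le hj
  have hzero := hmax.hasDerivAt_eq_zero (hasDerivAt_pi.1 ((hφ y).2 t) j)
  simp only [Pi.sub_apply] at hzero
  linarith

/-- The complement of a maximal cohesive set is cohesive. -/
lemma MaxCohesive.compl {n : ℕ} {W : Matrix (Fin n) (Fin n) ℝ} (hW : RowStochastic W)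
    {M : Finset (Fin n)} (hM : MaxCohesive W M) : Cohesive W Mᶜ := by
  intro i hi
  have hle := not_lt.1 (hM.2 i (mem_compl.1 hi))
  have hsplit := sum_add_sum_compl M (W i)
  rw [hW.2 i] at hsplit
  linarith

/-- If no cohesive set inside `Θ ∪ Mᶜ` meets the set `Θ` of maximizers over `M`, then all opinions
in `M` are strictly below the initial maximum at every positive time. -/
lemma MaxCohesive.flow_lt_of_repulsive {n : ℕ} {W : Matrix (Fin n) (Fin n) ℝ}
    (hW : RowStochastic W) {Med : (Fin n → ℝ) → Fin n → ℝ} (hMed : IsMedSelection W Med)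
    {φ : (Fin n → ℝ) → ℝ → (Fin n → ℝ)} (hφ : IsFlow (fun x => Med x - x) φ)
    {x0 : Fin n → ℝ} {M : Finset (Fin n)} (hM : MaxCohesive W M)
    (hTheta : ∀ C : Finset (Fin n), Cohesive W C →
        C ⊆ (M.filter (fun i => ∀ j ∈ M, x0 j ≤ x0 i)) ∪ Mᶜ →
        Disjoint C (M.filter (fun i => ∀ j ∈ M, x0 j ≤ x0 i)))
    {a : ℝ} (ha : ∀ j ∈ M, x0 j ≤ a) {t : ℝ} (ht : 0 < t) {i : Fin n} (hi : i ∈ M) :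
    φ x0 t i < a := by
  refine lt_of_le_of_ne (hM.1.flow_le hW hMed hφ ha ht.le hi) fun hia => ?_
  have htheta : ∀ k ∈ M, φ x0 t k = a → k ∈ M.filter (fun i => ∀ j ∈ M, x0 j ≤ x0 i) := by
    refine fun k hk hka => mem_filter.2 ⟨hk, fun j hj => ?_⟩
    by_contra! hlt
    exact (hM.1.flow_lt hW hMed hφ ha ht.le hk (hlt.trans_le (ha j hj))).ne hka
  refine disjoint_left.1 (hTheta (M.filter (fun k => φ x0 t k = a) ∪ Mᶜ) ?_ ?_)
    (mem_union_left _ (mem_filter.2 ⟨hi, hia⟩)) (htheta i hi hia)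
  · intro k hk
    rcases mem_union.1 hk with hk | hk
    · obtain ⟨hkM, hka⟩ := mem_filter.1 hk
      have hmed := hM.1.med_eq_of_flow_eq hW hMed hφ ha ht hkM hka
      have hlow := (hMed (φ x0 t) k).1.2.1
      rw [hmed] at hlow
      have hsplit := sum_filter_add_sum_filter_not univ (fun j => φ x0 t j < a) (W k)
      rw [hW.2 k] at hsplit
      refine le_trans (by linarith) (sum_le_sum_of_subset_of_nonneg
        (s := univ.filter fun j => ¬ φ x0 t j < a) ?_ fun j _ _ => hW.1 k j)
      intro j hj
      have hja : a ≤ φ x0 t j := by simpa using hj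
      by_cases hjM : j ∈ M
      · exact mem_union_left _
          (mem_filter.2 ⟨hjM, le_antisymm (hM.1.flow_le hW hMed hφ ha ht.le hjM) hja⟩)
      · exact mem_union_right _ (mem_compl.2 hjM)
    · exact (hM.compl hW k hk).trans
        (sum_le_sum_of_subset_of_nonneg subset_union_right fun j _ _ => hW.1 k j)
  · refine union_subset_union_left fun k hk => ?_
    exact htheta k (mem_filter.1 hk).1 (mem_filter.1 hk).2

/-- Downward behaviour from downward-repulsive states: the trajectory enters, within
finite time, a positively invariant set lying at positive distance from the initial
state, in which all opinions of the maximal cohesive set `M` are below the initial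
maximum over `M` by `ε`. -/
theorem downward_repulsive_behaviour {n : ℕ}
    (W : Matrix (Fin n) (Fin n) ℝ) (hW : RowStochastic W)
    (Med : (Fin n → ℝ) → Fin n → ℝ) (hMed : IsMedSelection W Med)
    (φ : (Fin n → ℝ) → ℝ → (Fin n → ℝ))
    (hφ : IsFlow (fun x => Med x - x) φ)
    (x0 : Fin n → ℝ) (M : Finset (Fin n)) (hMne : M.Nonempty)
    (hM : MaxCohesive W M)
    (hTheta : ∀ C : Finset (Fin n), Cohesive W C →
        C ⊆ (M.filter (fun i => ∀ j ∈ M, x0 j ≤ x0 i)) ∪ Mᶜ →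
        Disjoint C (M.filter (fun i => ∀ j ∈ M, x0 j ≤ x0 i))) :
    ∃ ε > (0:ℝ), ∃ τ ≥ (0:ℝ),
      φ x0 τ ∈ lowerInvSet M (M.sup' hMne x0) ε ∧
      (∀ y ∈ lowerInvSet M (M.sup' hMne x0) ε, ∀ t : ℝ, 0 ≤ t →
        φ y t ∈ lowerInvSet M (M.sup' hMne x0) ε) ∧
      0 < Metric.infDist x0 (lowerInvSet M (M.sup' hMne x0) ε) := by
  have hx0 : ∀ j ∈ M, x0 j ≤ M.sup' hMne x0 := fun j hj => le_sup' x0 hj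
  have hlt : M.sup' hMne (φ x0 1) < M.sup' hMne x0 :=
    (sup'_lt_iff hMne).2 fun i hi => hM.flow_lt_of_repulsive hW hMed hφ hTheta hx0 one_pos hi
  have hmem : φ x0 1 ∈
      lowerInvSet M (M.sup' hMne x0) (M.sup' hMne x0 - M.sup' hMne (φ x0 1)) := by
    intro j hj
    rw [sub_sub_cancel]
    exact le_sup' (φ x0 1) hj
  refine ⟨M.sup' hMne x0 - M.sup' hMne (φ x0 1), sub_pos.2 hlt, 1, zero_le_one, hmem,
    fun y hy t ht j hj => hM.1.flow_le hW hMed hφ hy ht hj, ?_⟩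
  have hclosed : IsClosed
      (lowerInvSet M (M.sup' hMne x0) (M.sup' hMne x0 - M.sup' hMne (φ x0 1))) := by
    simp only [lowerInvSet, Set.ofPred_forall]
    exact isClosed_biInter fun j _ => isClosed_le (continuous_apply j) continuous_const
  refine (hclosed.notMem_iff_infDist_pos ⟨_, hmem⟩).1 fun hx => ?_
  obtain ⟨i, hi, heq⟩ := exists_mem_eq_sup' hMne x0
  have hle := hx i hi
  linarith
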